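/- Let G = (V, E) be a finite simple graph, let A ⊆ V with cl(A) = S, let v ∈ V, and let x ∈ N(v) \ S. Then cl(A ∪ ((N[v] \ S) \ {x})) = cl(S ∪ N[v]). -/

import Mathlib

/-- A set `C` is closed under the zero forcing color change rule:
whenever a vertex `u ∈ C` has exactly one neighbor outside `C`,
that neighbor also belongs to `C`. -/
def ZFClosed {V : Type*} (G : SimpleGraph V) (C : Set V) : Prop :=
  ∀ u ∈ C, ∀ w : V, G.neighborSet u \ C = {w} → w ∈ C

/-- The zero forcing closure of `S`: the smallest set containing `S`
that is closed under the color change rule. -/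
def zfClosure {V : Type*} (G : SimpleGraph V) (S : Set V) : Set V :=
  ⋂₀ {C : Set V | S ⊆ C ∧ ZFClosed G C}

/-- A fort: a nonempty set such that no vertex outside it has exactly
one neighbor inside it. -/
def IsFort {V : Type*} (G : SimpleGraph V) (F : Set V) : Prop :=
  F.Nonempty ∧ ∀ v ∉ F, ¬ ∃ w : V, G.neighborSet v ∩ F = {w}

/-- The zero forcing number: minimum cardinality of a zero forcing set. -/
noncomputable def zfNumber {V : Type*} (G : SimpleGraph V) : ℕ :=
  sInf {k : ℕ | ∃ Z : Set V, zfClosure G Z = Set.univ ∧ Z.ncard = k}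

theorem subset_zfClosure {V : Type*} (G : SimpleGraph V) (A : Set V) : A ⊆ zfClosure G A :=
  Set.subset_sInter fun _ hC => hC.1

theorem zfClosure_subset {V : Type*} {G : SimpleGraph V} {A C : Set V} (hAC : A ⊆ C)
    (hC : ZFClosed G C) : zfClosure G A ⊆ C :=
  Set.sInter_subset_of_mem ⟨hAC, hC⟩

/-- A closed set containing `v` and all its neighbors except possibly `x` contains
all neighbors of `v`. -/
theorem ZFClosed.neighborSet_subset {V : Type*} {G : SimpleGraph V} {C : Set V}
    (hC : ZFClosed G C) {v x : V} (hv : v ∈ C) (hx : x ∈ G.neighborSet v)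
    (h : G.neighborSet v \ {x} ⊆ C) : G.neighborSet v ⊆ C := by
  have hxC : x ∈ C := by
    by_contra hxC
    refine hxC (hC v hv x (Set.Subset.antisymm (fun y hy => ?_) ?_))
    · by_contra hyx
      exact hy.2 (h ⟨hy.1, hyx⟩)
    · exact Set.singleton_subset_iff.2 ⟨hx, hxC⟩
  intro y hy
  by_cases hyx : y = x
  · exact hyx ▸ hxC
  · exact h ⟨hy, hyx⟩

theorem closure_add_neighborhood_minus_one {V : Type*} [Fintype V] (G : SimpleGraph V)
    (A S : Set V) (hA : zfClosure G A = S) (v : V) (x : V)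
    (hx : x ∈ G.neighborSet v \ S) :
    zfClosure G (A ∪ ((insert v (G.neighborSet v) \ S) \ {x})) =
      zfClosure G (S ∪ insert v (G.neighborSet v)) := by
  subst hA
  refine congrArg Set.sInter (Set.ext fun C => and_congr_left fun hC => ⟨fun h => ?_, fun h => ?_⟩)
  · have hS : zfClosure G A ⊆ C := zfClosure_subset (Set.subset_union_left.trans h) hC
    have hN : insert v (G.neighborSet v) \ {x} ⊆ C := fun y hy => by
      by_cases hyS : y ∈ zfClosure G A
      · exact hS hyS
      · exact h (Or.inr ⟨⟨hy.1, hyS⟩, hy.2⟩)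
    have hv : v ∈ C := hN ⟨Set.mem_insert _ _, G.ne_of_adj hx.1⟩
    exact Set.union_subset hS (Set.insert_subset hv (hC.neighborSet_subset hv hx.1
      ((Set.sdiff_subset_sdiff_left (Set.subset_insert _ _)).trans hN)))
  · exact (Set.union_subset_union (subset_zfClosure G A)
      (Set.sdiff_subset.trans Set.sdiff_subset)).trans h
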